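/- arXiv:1910.10259 — 9 statements merged into one kernel-verified Lean document; each statement's English description precedes it below -/
import Mathlib

section
/- If w, w' ∈ A* are such that w is a prefix of w' and |w'| = |w| + k for some k ≥ 0, then g(w') ≤ 4^{-k}·g(w). -/
theorem factorial_add_le_factorial_of_add_le {m n k : ℕ} (hn : 1 ≤ n) (h : n + k ≤ m) :
    n.factorial + k ≤ m.factorial := by
  refine le_trans ?_ (Nat.factorial_le h)
  induction k with
  | zero => simp
  | succ k ih =>
    have hk := ih (by lia)
    have hpos := Nat.factorial_pos (n + k)
    rw [← add_assoc n k 1, Nat.factorial_succ]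
    nlinarith

/-- Passing to an extension by `k` letters moves the index in a length-nondecreasing
enumeration by at least `k`. -/
theorem index_add_le_of_prefix {α : Type*} {σ : ℕ → List α}
    (hσ : ∀ w : List α, ∃! n : ℕ, 1 ≤ n ∧ σ n = w)
    (hmono : ∀ m n : ℕ, 1 ≤ m → m ≤ n → (σ m).length ≤ (σ n).length)
    {n : ℕ} (hn : 1 ≤ n) (v : List α) {m : ℕ} (hm : 1 ≤ m) (h : σ m = σ n ++ v) :
    n + v.length ≤ m := by
  induction v using List.reverseRecOn generalizing m with
  | nil =>
    have := (hσ (σ n)).unique ⟨hn, rfl⟩ ⟨hm, by simpa using h⟩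
    simp [this]
  | append_singleton v a ih =>
    obtain ⟨p, ⟨hp, hpv⟩, -⟩ := hσ (σ n ++ v)
    have hle := ih hp hpv
    have hlt : p < m := by
      by_contra! hmp
      have := hmono m p hm hmp
      simp [h, hpv] at this
    simp only [List.length_append, List.length_singleton]
    lia

/-- With `(σ_n)_{n≥1}` a bijective enumeration of all finite binary words
with nondecreasing lengths and `g(σ_n) = 4^{-n!}`: if `w` is a prefix of `w'` and
`|w'| = |w| + k` with `k ≥ 0`, then `g(w') ≤ 4^{-k} · g(w)`. -/
theorem g_prefix_decay
    (σ : ℕ → List Bool)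
    (hσ_bij : ∀ w : List Bool, ∃! n : ℕ, 1 ≤ n ∧ σ n = w)
    (hσ_mono : ∀ m n : ℕ, 1 ≤ m → m ≤ n → (σ m).length ≤ (σ n).length)
    (g : List Bool → ℝ)
    (hg : ∀ n : ℕ, 1 ≤ n → g (σ n) = (4 : ℝ) ^ (-(Nat.factorial n : ℤ)))
    (w w' : List Bool) (k : ℕ)
    (hpre : w <+: w') (hlen : w'.length = w.length + k) :
    g w' ≤ (4 : ℝ) ^ (-(k : ℤ)) * g w := by
  obtain ⟨v, rfl⟩ := hpre
  obtain ⟨n, ⟨hn, rfl⟩, -⟩ := hσ_bij w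
  obtain ⟨m, ⟨hm, hmv⟩, -⟩ := hσ_bij (σ n ++ v)
  have hk : v.length = k := by simpa using hlen
  have hfac := factorial_add_le_factorial_of_add_le hn
    (hk ▸ index_add_le_of_prefix hσ_bij hσ_mono hn v hm hmv)
  rw [← hmv, hg m hm, hg n hn, ← zpow_add₀ (by norm_num)]
  exact zpow_le_zpow_right₀ (by norm_num) (by lia)
end

section
/- Let ω, τ ∈ A^ℕ be distinct infinite binary sequences, let w := ω∧τ be their longest common prefix, let ℓ := |w|, and suppose that ω_{ℓ+1} = 0 and τ_{ℓ+1} = 1. Then (2/3)·g(w) ≤ f(τ) − f(ω) ≤ (4/3)·g(w). In particular, f is injective. -/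
/-- A subseries of a nonnegative series whose terms decay by a factor `4` is summable, and its tail
after index `ℓ` is at most a third of the term at `ℓ`. -/
lemma summable_ite_and_tail_le_third {a : ℕ → ℝ} (ha : ∀ n, 0 ≤ a n)
    (hdecay : ∀ n, a (n + 1) ≤ a n / 4) (b : ℕ → Bool) (ℓ : ℕ) :
    Summable (fun n => if b n = true then a n else 0) ∧
      0 ≤ ∑' k, (if b (k + (ℓ + 1)) = true then a (k + (ℓ + 1)) else 0) ∧
      ∑' k, (if b (k + (ℓ + 1)) = true then a (k + (ℓ + 1)) else 0) ≤ a ℓ / 3 := by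
  have hnonneg : ∀ n, 0 ≤ (if b n = true then a n else 0) := fun n => by
    split_ifs
    exacts [ha n, le_rfl]
  have hgeom : ∀ k, a (k + (ℓ + 1)) ≤ a ℓ / 4 * (1 / 4) ^ k := fun k => by
    induction k with
    | zero => simpa using hdecay ℓ
    | succ k ih =>
      have h := hdecay (k + (ℓ + 1))
      rw [show k + 1 + (ℓ + 1) = k + (ℓ + 1) + 1 by ring, pow_succ]
      linarith
  have hle : ∀ k, (if b (k + (ℓ + 1)) = true then a (k + (ℓ + 1)) else 0) ≤
      a ℓ / 4 * (1 / 4) ^ k := fun k => by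
    split_ifs
    · exact hgeom k
    · exact (ha _).trans (hgeom k)
  have hsum : HasSum (fun k : ℕ => a ℓ / 4 * (1 / 4 : ℝ) ^ k) (a ℓ / 3) := by
    have h := (hasSum_geometric_of_lt_one (r := (1 / 4 : ℝ)) (by norm_num)
      (by norm_num)).mul_left (a ℓ / 4)
    rwa [show a ℓ / 4 * (1 - 1 / 4)⁻¹ = a ℓ / 3 by ring] at h
  have htail : Summable fun k => if b (k + (ℓ + 1)) = true then a (k + (ℓ + 1)) else 0 :=
    Summable.of_nonneg_of_le (fun k => hnonneg _) hle hsum.summable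
  exact ⟨(summable_nat_add_iff (f := fun n => if b n = true then a n else 0) (ℓ + 1)).1 htail,
    tsum_nonneg fun k => hnonneg _, hsum.tsum_eq ▸ htail.tsum_le_tsum hle hsum.summable⟩

/-- If words are enumerated by nondecreasing length and `g` takes the value `4 ^ (-n!)` at the
`n`-th word, then `g` drops by a factor of at least `4` on longer words. -/
lemma pos_and_le_div_four_of_length_lt {σ : ℕ → List Bool}
    (hσ_surj : ∀ w : List Bool, ∃ n : ℕ, 1 ≤ n ∧ σ n = w)
    (hσ_mono : ∀ m n : ℕ, 1 ≤ m → m ≤ n → (σ m).length ≤ (σ n).length)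
    {g : List Bool → ℝ}
    (hg : ∀ n : ℕ, 1 ≤ n → g (σ n) = (4 : ℝ) ^ (-(Nat.factorial n : ℤ))) :
    (∀ u, 0 < g u) ∧ ∀ u v : List Bool, u.length < v.length → g v ≤ g u / 4 := by
  refine ⟨fun u => ?_, fun u v huv => ?_⟩
  · obtain ⟨n, hn, rfl⟩ := hσ_surj u
    rw [hg n hn]
    positivity
  · obtain ⟨m, hm, rfl⟩ := hσ_surj u
    obtain ⟨n, hn, rfl⟩ := hσ_surj v
    have hmn : m < n := by
      by_contra! h
      exact absurd (hσ_mono n m hn h) (by omega)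
    have hfact : m.factorial < n.factorial := (Nat.factorial_lt hm).2 hmn
    rw [hg m hm, hg n hn, div_eq_mul_inv, ← zpow_sub_one₀ (by norm_num : (4 : ℝ) ≠ 0)]
    exact zpow_le_zpow_right₀ (by norm_num) (by omega)


/-- With `(σ_n)_{n≥1}` a bijective enumeration of all finite binary words
with nondecreasing lengths, `g(σ_n) = 4^{-n!}`, and
`f(ω) = Σ_{n ≥ 0 : ω_{n+1} = 1} g(ω_1^n)`: if `ω ≠ τ` are infinite binary sequences with
longest common prefix `w` of length `ℓ`, and `ω_{ℓ+1} = 0`, `τ_{ℓ+1} = 1`, then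
`(2/3)·g(w) ≤ f(τ) − f(ω) ≤ (4/3)·g(w)`.  In particular, `f` is injective.
(Sequences are 0-indexed: `ω_{ℓ+1}` is `ω ℓ`.) -/
theorem f_difference_bounds_and_injective
    (σ : ℕ → List Bool)
    (hσ_bij : ∀ w : List Bool, ∃! n : ℕ, 1 ≤ n ∧ σ n = w)
    (hσ_mono : ∀ m n : ℕ, 1 ≤ m → m ≤ n → (σ m).length ≤ (σ n).length)
    (g : List Bool → ℝ)
    (hg : ∀ n : ℕ, 1 ≤ n → g (σ n) = (4 : ℝ) ^ (-(Nat.factorial n : ℤ)))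
    (f : (ℕ → Bool) → ℝ)
    (hf : ∀ ω : ℕ → Bool,
      f ω = ∑' n : ℕ, if ω n = true then g (List.ofFn fun i : Fin n => ω i) else 0)
    (ω τ : ℕ → Bool) (ℓ : ℕ) (w : List Bool)
    (hw : w = List.ofFn fun i : Fin ℓ => ω i)
    (hagree : ∀ i : ℕ, i < ℓ → ω i = τ i)
    (hω : ω ℓ = false) (hτ : τ ℓ = true) :
    (2 / 3 : ℝ) * g w ≤ f τ - f ω ∧ f τ - f ω ≤ (4 / 3 : ℝ) * g w ∧
      Function.Injective f := by
  obtain ⟨hpos, hlt⟩ := pos_and_le_div_four_of_length_lt (fun w => (hσ_bij w).exists) hσ_mono hg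
  have key : ∀ (ω τ : ℕ → Bool) (ℓ : ℕ), (∀ i, i < ℓ → ω i = τ i) → ω ℓ = false → τ ℓ = true →
      (2 / 3 : ℝ) * g (List.ofFn fun i : Fin ℓ => ω i) ≤ f τ - f ω ∧
        f τ - f ω ≤ (4 / 3 : ℝ) * g (List.ofFn fun i : Fin ℓ => ω i) := by
    intro ω τ ℓ hagree hω hτ
    have hprefix : ∀ n ≤ ℓ, (List.ofFn fun i : Fin n => τ i) = List.ofFn fun i : Fin n => ω i :=
      fun n hn => congrArg List.ofFn (funext fun i => (hagree i (i.2.trans_le hn)).symm)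
    have htail : ∀ α : ℕ → Bool, _ := fun α => summable_ite_and_tail_le_third
      (a := fun n => g (List.ofFn fun i : Fin n => α i)) (fun n => (hpos _).le)
      (fun n => hlt _ _ (by simp)) α ℓ
    obtain ⟨hsω, hω0, hω1⟩ := htail ω
    obtain ⟨hsτ, hτ0, hτ1⟩ := htail τ
    have hhead : ∑ n ∈ Finset.range ℓ,
          (if τ n = true then g (List.ofFn fun i : Fin n => τ i) else 0) =
        ∑ n ∈ Finset.range ℓ,
          (if ω n = true then g (List.ofFn fun i : Fin n => ω i) else 0) := by
      refine Finset.sum_congr rfl fun n hn => ?_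
      have hn := Finset.mem_range.1 hn
      rw [hprefix n hn.le, hagree n hn]
    have hfω := hf ω
    have hfτ := hf τ
    rw [← hsω.sum_add_tsum_nat_add (ℓ + 1), Finset.sum_range_succ, hω] at hfω
    rw [← hsτ.sum_add_tsum_nat_add (ℓ + 1), Finset.sum_range_succ, hτ, hhead,
      hprefix ℓ le_rfl] at hfτ
    simp only [Bool.false_eq_true, if_false, if_true] at hfω hfτ
    simp only [hprefix ℓ le_rfl] at hτ1
    constructor <;> linarith
  obtain ⟨hlower, hupper⟩ := key ω τ ℓ hagree hω hτ
  refine ⟨hw ▸ hlower, hw ▸ hupper, fun α β hαβ => ?_⟩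
  by_contra hne
  have hex : ∃ n, α n ≠ β n := Function.ne_iff.1 hne
  have hmin : ∀ i < Nat.find hex, α i = β i := fun i hi => not_not.1 (Nat.find_min hex hi)
  have hdiff := Nat.find_spec hex
  cases hα : α (Nat.find hex) <;> cases hβ : β (Nat.find hex)
  · exact hdiff (hα.trans hβ.symm)
  · linarith [(key α β _ hmin hα hβ).1, hpos (List.ofFn fun i : Fin (Nat.find hex) => α i)]
  · linarith [(key β α _ (fun i hi => (hmin i hi).symm) hβ hα).1,
      hpos (List.ofFn fun i : Fin (Nat.find hex) => β i)]
  · exact hdiff (hα.trans hβ.symm)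
end

section
/- For all ω, τ ∈ A^ℕ and all n ≥ 0, if ω and τ agree in their first n coordinates (i.e. ω_1^n = τ_1^n), then |f(ω) − f(τ)| ≤ 4^{-n}. In particular, f : A^ℕ → ℝ is continuous when A^ℕ carries the product topology. -/
/-- In an enumeration of the words with nondecreasing lengths, a word of length `k` has index
larger than `k`. -/
theorem length_lt_index_of_monotone_enumeration {σ : ℕ → List Bool}
    (hσ_surj : ∀ w : List Bool, ∃ n : ℕ, 1 ≤ n ∧ σ n = w)
    (hσ_mono : ∀ m n : ℕ, 1 ≤ m → m ≤ n → (σ m).length ≤ (σ n).length)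
    {m : ℕ} (hm : 1 ≤ m) : (σ m).length < m := by
  suffices h : ∀ w : List Bool, ∀ m : ℕ, 1 ≤ m → σ m = w → w.length < m from h _ m hm rfl
  intro w
  induction w with
  | nil => exact fun m hm _ => hm
  | cons a w ih =>
    intro m hm hw
    obtain ⟨j, hj, hjw⟩ := hσ_surj w
    have hlt : j < m := by
      by_contra! hle
      have := hσ_mono m j hm hle
      simp [hw, hjw] at this
    have := ih j hj hjw
    simp only [List.length_cons]
    omega

/-- The weight of a word is nonnegative and at most `4^{-(k+1)}`, where `k` is its length. -/
theorem weight_mem_Icc {σ : ℕ → List Bool}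
    (hσ_surj : ∀ w : List Bool, ∃ n : ℕ, 1 ≤ n ∧ σ n = w)
    (hσ_mono : ∀ m n : ℕ, 1 ≤ m → m ≤ n → (σ m).length ≤ (σ n).length)
    {g : List Bool → ℝ}
    (hg : ∀ n : ℕ, 1 ≤ n → g (σ n) = (4 : ℝ) ^ (-(Nat.factorial n : ℤ))) (w : List Bool) :
    g w ∈ Set.Icc 0 ((1 / 4 : ℝ) ^ (w.length + 1)) := by
  obtain ⟨m, hm, rfl⟩ := hσ_surj w
  have hlt := length_lt_index_of_monotone_enumeration hσ_surj hσ_mono hm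
  rw [hg m hm, zpow_neg, zpow_natCast, ← inv_pow, ← one_div]
  exact ⟨by positivity, pow_le_pow_of_le_one (by norm_num) (by norm_num)
    (hlt.trans_le m.self_le_factorial)⟩

/-- The `n`-th term of the series defining `f` lies between `0` and `4^{-(n+1)}`. -/
theorem series_term_mem_Icc {g : List Bool → ℝ}
    (hg : ∀ w, g w ∈ Set.Icc 0 ((1 / 4 : ℝ) ^ (w.length + 1))) (ω : ℕ → Bool) (n : ℕ) :
    (if ω n = true then g (List.ofFn fun i : Fin n => ω i) else 0) ∈
      Set.Icc 0 ((1 / 4 : ℝ) ^ (n + 1)) := by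
  split_ifs
  · simpa using hg (List.ofFn fun i : Fin n => ω i)
  · exact ⟨le_rfl, by positivity⟩


/-- With the enumeration `σ`, the weight `g(σ_n) = 4^{-n!}`, and
`f(ω) = Σ_{n ≥ 0 : ω_{n+1} = 1} g(ω_1^n)`: for all infinite binary sequences `ω, τ`
agreeing in their first `n` coordinates, `|f(ω) − f(τ)| ≤ 4^{-n}`.  In particular,
`f` is continuous for the product topology on `ℕ → Bool`. -/
theorem f_holder_and_continuous
    (σ : ℕ → List Bool)
    (hσ_bij : ∀ w : List Bool, ∃! n : ℕ, 1 ≤ n ∧ σ n = w)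
    (hσ_mono : ∀ m n : ℕ, 1 ≤ m → m ≤ n → (σ m).length ≤ (σ n).length)
    (g : List Bool → ℝ)
    (hg : ∀ n : ℕ, 1 ≤ n → g (σ n) = (4 : ℝ) ^ (-(Nat.factorial n : ℤ)))
    (f : (ℕ → Bool) → ℝ)
    (hf : ∀ ω : ℕ → Bool,
      f ω = ∑' n : ℕ, if ω n = true then g (List.ofFn fun i : Fin n => ω i) else 0)
    (ω τ : ℕ → Bool) (n : ℕ) (hagree : ∀ i : ℕ, i < n → ω i = τ i) :
    |f ω - f τ| ≤ (4 : ℝ) ^ (-(n : ℤ)) ∧ Continuous f := by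
  have hg_mem := weight_mem_Icc (fun w => (hσ_bij w).exists) hσ_mono hg
  have hgeom : Summable fun k : ℕ => (1 / 4 : ℝ) ^ (k + 1) :=
    (summable_nat_add_iff 1).2 (summable_geometric_of_lt_one (by norm_num) (by norm_num))
  have hterm := series_term_mem_Icc hg_mem
  have hsum (ω : ℕ → Bool) : Summable fun k : ℕ =>
      if ω k = true then g (List.ofFn fun i : Fin k => ω i) else 0 :=
    hgeom.of_nonneg_of_le (fun k => (hterm ω k).1) (fun k => (hterm ω k).2)
  constructor
  · have htail : HasSum (fun k : ℕ => (1 / 4 : ℝ) ^ (k + n + 1)) ((1 / 4 : ℝ) ^ n / 3) := by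
      convert (hasSum_geometric_of_lt_one (r := (1 / 4 : ℝ)) (by norm_num)
        (by norm_num)).mul_right ((1 / 4 : ℝ) ^ (n + 1)) using 1
      · rfl
      · funext k
        ring
      · ring
    have hterm_eq (k : ℕ) (hk : k < n) :
        (if ω k = true then g (List.ofFn fun i : Fin k => ω i) else 0) =
          if τ k = true then g (List.ofFn fun i : Fin k => τ i) else 0 := by
      have hfun : (fun i : Fin k => ω i) = fun i : Fin k => τ i :=
        funext fun i => hagree i (i.2.trans hk)
      rw [hagree k hk, hfun]
    rw [hf ω, hf τ, ← (hsum ω).tsum_sub (hsum τ),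
      ← ((hsum ω).sub (hsum τ)).sum_add_tsum_nat_add n,
      Finset.sum_eq_zero fun k hk => sub_eq_zero.2 (hterm_eq k (Finset.mem_range.1 hk)), zero_add]
    rw [← Real.norm_eq_abs]
    refine (tsum_of_norm_bounded htail fun k => ?_).trans ?_
    · simpa using abs_sub_le_of_le_of_le (hterm ω (k + n)).1 (hterm ω (k + n)).2
        (hterm τ (k + n)).1 (hterm τ (k + n)).2
    · rw [zpow_neg, zpow_natCast, ← inv_pow, ← one_div]
      exact div_le_self (by positivity) (by norm_num)
  · rw [funext hf]
    refine continuous_tsum (fun k => ?_) hgeom fun k ω => ?_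
    · have hdisc : Continuous fun p : Bool × (Fin k → Bool) =>
          if p.1 = true then g (List.ofFn p.2) else 0 := continuous_of_discreteTopology
      exact hdisc.comp (by fun_prop : Continuous fun ω : ℕ → Bool =>
        (ω k, fun i : Fin k => ω i))
    · rw [Real.norm_of_nonneg (hterm ω k).1]
      exact (hterm ω k).2
end

section
/- The set K := f(A^ℕ) = { f(ω) : ω ∈ A^ℕ } is a perfect subset of ℝ (i.e. K is closed and has no isolated points), and 0 ∈ K. -/
open Filter Topology

/-- The `n`-th summand of `f ω`: the weight of the length-`n` prefix of `ω` if `ω n` is `true`. -/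
noncomputable def prefixTerm (g : List Bool → ℝ) (ω : ℕ → Bool) (n : ℕ) : ℝ :=
  if ω n = true then g (List.ofFn fun i : Fin n => ω i) else 0

lemma prefixTerm_congr (g : List Bool → ℝ) {ω ω' : ℕ → Bool} {n : ℕ}
    (h : ∀ i ≤ n, ω i = ω' i) : prefixTerm g ω n = prefixTerm g ω' n := by
  have h' : (fun i : Fin n => ω i) = fun i : Fin n => ω' i := funext fun i => h i i.2.le
  simp only [prefixTerm, h n le_rfl, h']

lemma prefixTerm_of_eq_false (g : List Bool → ℝ) {ω : ℕ → Bool} {n : ℕ} (h : ω n = false) :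
    prefixTerm g ω n = 0 := by
  simp [prefixTerm, h]

lemma prefixTerm_nonneg {g : List Bool → ℝ} (hg : ∀ w, 0 < g w) (ω : ℕ → Bool) (n : ℕ) :
    0 ≤ prefixTerm g ω n := by
  unfold prefixTerm
  split_ifs
  exacts [(hg _).le, le_rfl]

lemma prefixTerm_pos {g : List Bool → ℝ} (hg : ∀ w, 0 < g w) {ω : ℕ → Bool} {n : ℕ}
    (h : ω n = true) : 0 < prefixTerm g ω n := by
  simpa [prefixTerm, h] using hg _

lemma continuous_prefixTerm (g : List Bool → ℝ) (n : ℕ) :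
    Continuous fun ω => prefixTerm g ω n := by
  refine IsLocallyConstant.continuous ((IsLocallyConstant.iff_eventually_eq _).2 fun ω => ?_)
  have h : ∀ᶠ ω' in 𝓝 ω, ∀ i ∈ Set.Iic n, ω' i = ω i :=
    (Set.finite_Iic n).eventually_all.2 fun i _ =>
      ((continuous_apply i).continuousAt (x := ω)).eventually_mem
        ((isOpen_discrete {ω i}).mem_nhds rfl)
  filter_upwards [h] with ω' h using prefixTerm_congr g h

/-- Any sequence can be changed past any given coordinate so as to change the sum. -/
lemma exists_eq_below_tsum_prefixTerm_ne {g : List Bool → ℝ} (hg : ∀ w, 0 < g w)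
    (hs : ∀ ω, Summable (prefixTerm g ω)) (ω : ℕ → Bool) (m : ℕ) :
    ∃ ω' : ℕ → Bool, (∀ i < m, ω' i = ω i) ∧ ∑' n, prefixTerm g ω' n ≠ ∑' n, prefixTerm g ω n := by
  by_cases h : ∃ k, m ≤ k ∧ ω k = true
  · obtain ⟨k, hmk, hk⟩ := h
    have hlt : ∀ i < m, (if i < m then ω i else false) = ω i := fun i hi => if_pos hi
    have hge : ∀ i, m ≤ i → (if i < m then ω i else false) = false := fun i hi => if_neg hi.not_gt
    refine ⟨fun i => if i < m then ω i else false, hlt, ne_of_lt ?_⟩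
    refine Summable.tsum_lt_tsum (i := k) (fun n => ?_) ?_ (hs _) (hs _)
    · rcases lt_or_ge n m with hn | hn
      · exact (prefixTerm_congr g fun i hi => hlt i (hi.trans_lt hn)).le
      · rw [prefixTerm_of_eq_false g (hge n hn)]
        exact prefixTerm_nonneg hg ω n
    · rw [prefixTerm_of_eq_false g (hge k hmk)]
      exact prefixTerm_pos hg hk
  · push Not at h
    have hω : ∀ k, m ≤ k → ω k = false := fun k hk => by simpa using h k hk
    have hlt : ∀ i < m, Function.update ω m true i = ω i :=
      fun i hi => Function.update_of_ne hi.ne _ _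
    refine ⟨Function.update ω m true, hlt, ne_of_gt ?_⟩
    refine Summable.tsum_lt_tsum (i := m) (fun n => ?_) ?_ (hs _) (hs _)
    · rcases lt_or_ge n m with hn | hn
      · exact (prefixTerm_congr g fun i hi => hlt i (hi.trans_lt hn)).ge
      · rw [prefixTerm_of_eq_false g (hω n hn)]
        exact prefixTerm_nonneg hg _ n
    · rw [prefixTerm_of_eq_false g (hω m le_rfl)]
      exact prefixTerm_pos hg (by simp)

lemma perfect_range_tsum_prefixTerm {g : List Bool → ℝ} (hg : ∀ w, 0 < g w) {u : ℕ → ℝ}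
    (hu : Summable u) (hgu : ∀ w, g w ≤ u w.length) :
    Perfect (Set.range fun ω => ∑' n, prefixTerm g ω n) := by
  have hle : ∀ n ω, ‖prefixTerm g ω n‖ ≤ u n := fun n ω => by
    have hw : g (List.ofFn fun i : Fin n => ω i) ≤ u n := by
      simpa using hgu (List.ofFn fun i : Fin n => ω i)
    rw [Real.norm_of_nonneg (prefixTerm_nonneg hg ω n)]
    unfold prefixTerm
    split_ifs
    exacts [hw, (hg _).le.trans hw]
  have hs : ∀ ω, Summable (prefixTerm g ω) := fun ω => hu.of_norm_bounded fun n => hle n ω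
  have hc : Continuous fun ω => ∑' n, prefixTerm g ω n :=
    continuous_tsum (continuous_prefixTerm g) hu hle
  refine ⟨(isCompact_range hc).isClosed, ?_⟩
  rintro _ ⟨ω, rfl⟩
  rw [accPt_iff_nhds]
  intro U hU
  choose ω' hω' hne using exists_eq_below_tsum_prefixTerm_ne hg hs ω
  have ht : Tendsto ω' atTop (𝓝 ω) := tendsto_pi_nhds.2 fun i =>
    tendsto_const_nhds.congr' <| (eventually_gt_atTop i).mono fun m hm => (hω' m i hm).symm
  obtain ⟨m, hm⟩ := (((hc.tendsto ω).comp ht).eventually_mem hU).exists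
  exact ⟨_, ⟨hm, ω' m, rfl⟩, hne m⟩

/-- In a length-nondecreasing enumeration starting at `1`, a word comes no earlier than the
position given by its length. -/
lemma length_le_index {σ : ℕ → List Bool} (hσ_surj : ∀ w, ∃ n, 1 ≤ n ∧ σ n = w)
    (hσ_mono : ∀ m n : ℕ, 1 ≤ m → m ≤ n → (σ m).length ≤ (σ n).length)
    {n : ℕ} (hn : 1 ≤ n) : (σ n).length ≤ n := by
  induction hl : (σ n).length generalizing n with
  | zero => exact n.zero_le
  | succ k ih =>
    obtain ⟨m, hm, hσm⟩ := hσ_surj (List.replicate k true)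
    have hmk : (σ m).length = k := by simp [hσm]
    have hmn : m < n := by
      by_contra! h
      have := hσ_mono n m hn h
      omega
    have := ih hm hmk
    omega

/-- With the enumeration `σ`, the weight `g(σ_n) = 4^{-n!}`, and
`f(ω) = Σ_{n ≥ 0 : ω_{n+1} = 1} g(ω_1^n)`: the set `K := f(A^ℕ)` is a perfect subset of
`ℝ` (closed with no isolated points), and `0 ∈ K`. -/
theorem K_perfect_and_contains_zero
    (σ : ℕ → List Bool)
    (hσ_bij : ∀ w : List Bool, ∃! n : ℕ, 1 ≤ n ∧ σ n = w)
    (hσ_mono : ∀ m n : ℕ, 1 ≤ m → m ≤ n → (σ m).length ≤ (σ n).length)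
    (g : List Bool → ℝ)
    (hg : ∀ n : ℕ, 1 ≤ n → g (σ n) = (4 : ℝ) ^ (-(Nat.factorial n : ℤ)))
    (f : (ℕ → Bool) → ℝ)
    (hf : ∀ ω : ℕ → Bool,
      f ω = ∑' n : ℕ, if ω n = true then g (List.ofFn fun i : Fin n => ω i) else 0) :
    Perfect (Set.range f) ∧ (0 : ℝ) ∈ Set.range f := by
  have hσ_surj : ∀ w, ∃ n, 1 ≤ n ∧ σ n = w := fun w => (hσ_bij w).exists
  have hpos : ∀ w, 0 < g w := fun w => by
    obtain ⟨n, hn, rfl⟩ := hσ_surj w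
    rw [hg n hn]
    positivity
  have hgu : ∀ w, g w ≤ (1 / 4 : ℝ) ^ w.length := fun w => by
    obtain ⟨n, hn, rfl⟩ := hσ_surj w
    rw [hg n hn, zpow_neg, zpow_natCast, ← inv_pow, ← one_div]
    exact pow_le_pow_of_le_one (by norm_num) (by norm_num)
      ((length_le_index hσ_surj hσ_mono hn).trans n.self_le_factorial)
  have hf' : f = fun ω => ∑' n, prefixTerm g ω n := funext hf
  refine ⟨?_, fun _ => false, by simp [hf]⟩
  rw [hf']
  exact perfect_range_tsum_prefixTerm hpos
    (summable_geometric_of_lt_one (by norm_num) (by norm_num)) hgu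
end

section
/- Let λ ∈ (0,1), let F be a finite index set with #F ≥ 2, and let (r_a)_{a∈F} be real numbers with 0 < r_a ≤ λ for each a ∈ F. Let δ > 0 be the unique positive real number with Σ_{a∈F} r_a^δ = 1. Then there exist constants c, C > 0 (depending only on λ and (r_a)_{a∈F}) such that for every r_b ∈ (0, λ], the unique positive real number s with Σ_{a∈F} r_a^s + r_b^s = 1 satisfies δ + c·r_b^δ ≤ s ≤ δ + C·r_b^δ. -/
/-- Adding a branch to a family of contraction ratios strictly increases the root of Moran's
equation. -/
theorem lt_of_sum_rpow_add_rpow_eq_one {α : Type*} {F : Finset α} {r : α → ℝ} {δ s ρ : ℝ}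
    (hr : ∀ a ∈ F, 0 < r a ∧ r a ≤ 1) (hδ : ∑ a ∈ F, r a ^ δ = 1) (hρ : 0 < ρ)
    (hs : (∑ a ∈ F, r a ^ s) + ρ ^ s = 1) : δ < s := by
  by_contra! hle
  have hsum : ∑ a ∈ F, r a ^ δ ≤ ∑ a ∈ F, r a ^ s := Finset.sum_le_sum fun a ha =>
    Real.rpow_le_rpow_of_exponent_ge (hr a ha).1 (hr a ha).2 hle
  linarith [Real.rpow_pos_of_pos hρ s]

/-- Let `λ ∈ (0,1)`, `F` a finite index set with `#F ≥ 2`, and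
`(r_a)_{a∈F}` reals with `0 < r_a ≤ λ`.  Let `δ > 0` be the unique positive real with
`Σ_{a∈F} r_a^δ = 1`.  Then there are constants `c, C > 0` (depending only on `λ` and
`(r_a)`) such that for every `r_b ∈ (0, λ]`, the unique positive real `s` with
`Σ_{a∈F} r_a^s + r_b^s = 1` satisfies `δ + c·r_b^δ ≤ s ≤ δ + C·r_b^δ`. -/
theorem dimension_increase_of_added_branch {α : Type*}
    (lam : ℝ) (hlam₀ : 0 < lam) (hlam₁ : lam < 1)
    (F : Finset α) (hF : 2 ≤ F.card)
    (r : α → ℝ) (hr : ∀ a ∈ F, 0 < r a ∧ r a ≤ lam)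
    (δ : ℝ) (hδ : 0 < δ) (hδeq : ∑ a ∈ F, r a ^ δ = 1) :
    ∃ c C : ℝ, 0 < c ∧ 0 < C ∧
      ∀ rb : ℝ, 0 < rb → rb ≤ lam →
        ∀ s : ℝ, 0 < s → (∑ a ∈ F, r a ^ s) + rb ^ s = 1 →
          δ + c * rb ^ δ ≤ s ∧ s ≤ δ + C * rb ^ δ := by
  have hne : F.Nonempty := Finset.card_pos.mp (by omega)
  have hloglam : 0 < -Real.log lam := neg_pos.mpr (Real.log_neg hlam₀ hlam₁)
  have hlamδ : lam ^ δ < 1 := Real.rpow_lt_one hlam₀.le hlam₁ hδ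
  set K := (1 - lam ^ δ) * -Real.log lam with hK_def
  have hK : 0 < K := mul_pos (by linarith) hloglam
  set L := ∑ a ∈ F, r a ^ δ * -Real.log (r a) with hL_def
  have hL : 0 < L := Finset.sum_pos (fun a ha => mul_pos (Real.rpow_pos_of_pos (hr a ha).1 _)
    (neg_pos.mpr (Real.log_neg (hr a ha).1 ((hr a ha).2.trans_lt hlam₁)))) hne
  refine ⟨Real.exp (-(1 / (K * δ))) / L, 1 / K, by positivity, by positivity, ?_⟩
  intro rb hrb₀ hrb s _ hs
  have hδs : δ < s := lt_of_sum_rpow_add_rpow_eq_one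
    (fun a ha => ⟨(hr a ha).1, (hr a ha).2.trans hlam₁.le⟩) hδeq hrb₀ hs
  have hy : 0 < rb ^ δ := Real.rpow_pos_of_pos hrb₀ _
  have hyl : rb ^ δ ≤ lam ^ δ := Real.rpow_le_rpow hrb₀.le hrb hδ.le
  have hsplit : ∀ x : ℝ, 0 < x → x ^ s = x ^ δ * x ^ (s - δ) := fun x hx => by
    rw [← Real.rpow_add hx, add_sub_cancel]
  have hupper : s - δ ≤ rb ^ δ / K := by
    have hsum : ∑ a ∈ F, r a ^ s ≤ lam ^ (s - δ) := by
      calc ∑ a ∈ F, r a ^ s ≤ ∑ a ∈ F, r a ^ δ * lam ^ (s - δ) :=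
            Finset.sum_le_sum fun a ha => by
              rw [hsplit _ (hr a ha).1]
              exact mul_le_mul_of_nonneg_left
                (Real.rpow_le_rpow (hr a ha).1.le (hr a ha).2 (by linarith))
                (Real.rpow_nonneg (hr a ha).1.le _)
        _ = lam ^ (s - δ) := by rw [← Finset.sum_mul, hδeq, one_mul]
    have hrbs : rb ^ s ≤ rb ^ δ :=
      Real.rpow_le_rpow_of_exponent_ge hrb₀ (hrb.trans hlam₁.le) hδs.le
    have hlog : Real.log (1 - rb ^ δ) ≤ (s - δ) * Real.log lam := by
      rw [← Real.log_rpow hlam₀]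
      exact Real.log_le_log (by linarith) (by linarith)
    have hpos : 0 < 1 - rb ^ δ := by linarith
    have hinv := Real.one_sub_inv_le_log_of_pos hpos
    have hdiv : (1 - rb ^ δ)⁻¹ - 1 ≤ rb ^ δ / (1 - lam ^ δ) := by
      have : (1 - rb ^ δ)⁻¹ - 1 = rb ^ δ / (1 - rb ^ δ) := by
        field_simp
        ring
      rw [this]
      exact div_le_div_of_nonneg_left hy.le (by linarith) (by linarith)
    rw [hK_def, ← div_div, le_div_iff₀ hloglam]
    linarith
  have hlower : Real.exp (-(1 / (K * δ))) * rb ^ δ ≤ (s - δ) * L := by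
    have hsum : rb ^ s ≤ (s - δ) * L := by
      have : rb ^ s = ∑ a ∈ F, r a ^ δ * (1 - r a ^ (s - δ)) := by
        have : ∑ a ∈ F, r a ^ δ * (1 - r a ^ (s - δ)) = ∑ a ∈ F, (r a ^ δ - r a ^ s) :=
          Finset.sum_congr rfl fun a ha => by rw [hsplit _ (hr a ha).1]; ring
        rw [this, Finset.sum_sub_distrib, hδeq]
        linarith
      rw [this, hL_def, Finset.mul_sum]
      refine Finset.sum_le_sum fun a ha => ?_
      have h := Real.add_one_le_exp (Real.log (r a) * (s - δ))
      rw [← Real.rpow_def_of_pos (hr a ha).1] at h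
      calc r a ^ δ * (1 - r a ^ (s - δ)) ≤ r a ^ δ * ((s - δ) * -Real.log (r a)) :=
            mul_le_mul_of_nonneg_left (by linarith) (Real.rpow_nonneg (hr a ha).1.le _)
        _ = (s - δ) * (r a ^ δ * -Real.log (r a)) := by ring
    have hpow : Real.exp (-(1 / (K * δ))) ≤ rb ^ (s - δ) := by
      rw [Real.rpow_def_of_pos hrb₀, Real.exp_le_exp]
      have hlogrb : 0 ≤ -Real.log rb :=
        neg_nonneg.mpr (Real.log_nonpos hrb₀.le (hrb.trans hlam₁.le))
      have hylog : rb ^ δ * -Real.log rb ≤ 1 / δ := by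
        have h := mul_le_mul_of_nonneg_left (Real.one_sub_inv_le_log_of_pos hy) hy.le
        rw [Real.log_rpow hrb₀, mul_sub, mul_inv_cancel₀ hy.ne'] at h
        rw [le_div_iff₀ hδ]
        linarith
      have h := calc (s - δ) * -Real.log rb ≤ rb ^ δ / K * -Real.log rb :=
            mul_le_mul_of_nonneg_right hupper hlogrb
        _ = rb ^ δ * -Real.log rb / K := by ring
        _ ≤ 1 / δ / K := div_le_div_of_nonneg_right hylog hK.le
        _ = 1 / (K * δ) := by rw [div_div, mul_comm]
      linarith
    calc Real.exp (-(1 / (K * δ))) * rb ^ δ ≤ rb ^ (s - δ) * rb ^ δ :=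
          mul_le_mul_of_nonneg_right hpow hy.le
      _ = rb ^ s := by rw [hsplit _ hrb₀, mul_comm]
      _ ≤ (s - δ) * L := hsum
  constructor
  · have h := (div_le_iff₀ hL).mpr hlower
    rw [mul_div_right_comm] at h
    linarith
  · rw [one_div_mul_eq_div]
    linarith
end

section
/- Fix a₁ < a₂ in ℕ. There exist constants c, C > 0, depending only on a₁ and a₂, with the following property: for every integer m ≥ a₂ and every finite set F with {a₁, a₂} ⊆ F ⊆ {1, ..., m}, one has c·2^{-(m+1)²·s(F∪{m+1})} ≤ s(F∪{m+1}) − s(F) ≤ C·2^{-(m+1)²·s(F∪{m+1})}. -/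
/-- The Moran sum `Σ_{a ∈ F} 2^{-a²·s}` for a finite set `F ⊆ ℕ`. -/
noncomputable def moranSumSq (F : Finset ℕ) (s : ℝ) : ℝ :=
  ∑ a ∈ F, (2 : ℝ) ^ (-((a : ℝ) ^ 2) * s)

theorem one_add_mul_log_two_le_two_rpow (y : ℝ) : 1 + y * Real.log 2 ≤ (2 : ℝ) ^ y := by
  rw [Real.rpow_def_of_pos two_pos]
  linarith [Real.add_one_le_exp (Real.log 2 * y)]

theorem two_rpow_sub_le {b s t : ℝ} (hb : 0 ≤ b) (hst : s ≤ t) :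
    (2 : ℝ) ^ (-b * s) - (2 : ℝ) ^ (-b * t) ≤ (t - s) * (b * (2 : ℝ) ^ (-b * s)) := by
  have h : (2 : ℝ) ^ (-b * t) = (2 : ℝ) ^ (-b * s) * (2 : ℝ) ^ (-b * (t - s)) := by
    rw [← Real.rpow_add two_pos]
    ring_nf
  have h1 := one_add_mul_log_two_le_two_rpow (-b * (t - s))
  have h2 : 0 < (2 : ℝ) ^ (-b * s) := Real.rpow_pos_of_pos two_pos _
  have h3 : b * (t - s) * Real.log 2 ≤ b * (t - s) :=
    mul_le_of_le_one_right (mul_nonneg hb (sub_nonneg.2 hst)) (by linarith [Real.log_two_lt_d9])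
  rw [h]
  nlinarith

theorem le_two_rpow_sub (b s t : ℝ) :
    (t - s) * (b * Real.log 2 * (2 : ℝ) ^ (-b * t)) ≤
      (2 : ℝ) ^ (-b * s) - (2 : ℝ) ^ (-b * t) := by
  have h : (2 : ℝ) ^ (-b * s) = (2 : ℝ) ^ (-b * t) * (2 : ℝ) ^ (b * (t - s)) := by
    rw [← Real.rpow_add two_pos]
    ring_nf
  have h1 := one_add_mul_log_two_le_two_rpow (b * (t - s))
  have h2 : 0 < (2 : ℝ) ^ (-b * t) := Real.rpow_pos_of_pos two_pos _
  rw [h]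
  nlinarith

theorem moranSumSq_antitone (F : Finset ℕ) : Antitone (moranSumSq F) := by
  intro s t hst
  refine Finset.sum_le_sum fun a _ => Real.rpow_le_rpow_of_exponent_le one_le_two ?_
  nlinarith [sq_nonneg (a : ℝ)]

theorem two_rpow_neg_sq_mul_le {a : ℕ} {s : ℝ} (hs : 0 ≤ s) :
    (2 : ℝ) ^ (-((a : ℝ) ^ 2) * s) ≤ ((2 : ℝ) ^ (-s)) ^ a := by
  rw [← Real.rpow_natCast ((2 : ℝ) ^ (-s)), ← Real.rpow_mul two_pos.le]
  refine Real.rpow_le_rpow_of_exponent_le one_le_two ?_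
  have h : (a : ℝ) ≤ (a : ℝ) ^ 2 := by exact_mod_cast Nat.le_self_pow two_ne_zero a
  nlinarith

theorem le_one_of_moranSumSq_eq_one {F : Finset ℕ} (hF : 0 ∉ F) {t : ℝ}
    (h : moranSumSq F t = 1) : t ≤ 1 := by
  by_contra! ht
  have hq0 : (0 : ℝ) ≤ (2 : ℝ) ^ (-t) := (Real.rpow_pos_of_pos two_pos _).le
  have hq : (2 : ℝ) ^ (-t) < 1 / 2 := by
    calc (2 : ℝ) ^ (-t) < (2 : ℝ) ^ (-1 : ℝ) :=
          Real.rpow_lt_rpow_of_exponent_lt one_lt_two (by linarith)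
      _ = 1 / 2 := by rw [Real.rpow_neg_one]; norm_num
  generalize hqd : (2 : ℝ) ^ (-t) = q at hq0 hq
  have hle : (1 : ℝ) ≤ ∑ a ∈ F, q ^ a := by
    rw [← h, moranSumSq]
    refine Finset.sum_le_sum fun a _ => ?_
    rw [← hqd]
    exact two_rpow_neg_sq_mul_le (by linarith)
  have hsum := (summable_geometric_of_lt_one hq0 (by linarith)).sum_le_tsum (insert 0 F)
    fun i _ => pow_nonneg hq0 i
  rw [Finset.sum_insert hF, tsum_geometric_of_lt_one hq0 (by linarith), pow_zero] at hsum
  have hlt : (1 - q)⁻¹ < 2 := by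
    rw [inv_lt_comm₀ (by linarith) two_pos]
    linarith
  linarith

theorem one_le_sq_mul_of_moranSumSq_eq_one {F : Finset ℕ} {a b : ℕ} (hab : a < b)
    (ha : a ∈ F) (hb : b ∈ F) {s : ℝ} (hs : 0 ≤ s) (h : moranSumSq F s = 1) :
    1 ≤ (b : ℝ) ^ 2 * s := by
  have hsub : ({a, b} : Finset ℕ) ⊆ F := by
    simp [Finset.insert_subset_iff, ha, hb]
  have hle := Finset.sum_le_sum_of_subset_of_nonneg
    (f := fun a : ℕ => (2 : ℝ) ^ (-((a : ℝ) ^ 2) * s)) hsub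
    fun i _ _ => (Real.rpow_pos_of_pos two_pos _).le
  rw [Finset.sum_pair hab.ne] at hle
  change _ ≤ moranSumSq F s at hle
  have hmono : (2 : ℝ) ^ (-((b : ℝ) ^ 2) * s) ≤ (2 : ℝ) ^ (-((a : ℝ) ^ 2) * s) := by
    refine Real.rpow_le_rpow_of_exponent_le one_le_two ?_
    have : (a : ℝ) ^ 2 ≤ (b : ℝ) ^ 2 := by gcongr
    nlinarith
  have hhalf : (2 : ℝ) ^ (-((b : ℝ) ^ 2) * s) ≤ (2 : ℝ) ^ (-1 : ℝ) := by
    rw [Real.rpow_neg_one]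
    linarith
  have := (Real.rpow_le_rpow_left_iff one_lt_two).1 hhalf
  linarith


/-- Claim 4.1 of the paper, via Moran's equation: Fix `a₁ < a₂` in
`ℕ = {1,2,...}`.  There are constants `c, C > 0`, depending only on `a₁, a₂`, such that
for every integer `m ≥ a₂` and every finite `F` with `{a₁, a₂} ⊆ F ⊆ {1, ..., m}`,
`c·2^{-(m+1)²·s(F∪{m+1})} ≤ s(F∪{m+1}) − s(F) ≤ C·2^{-(m+1)²·s(F∪{m+1})}`,
where `s(G)` denotes the unique positive root of `Σ_{a∈G} 2^{-a²·s} = 1`. -/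
theorem moran_root_increment_bounds
    (a₁ a₂ : ℕ) (ha₁ : 1 ≤ a₁) (ha : a₁ < a₂) :
    ∃ c C : ℝ, 0 < c ∧ 0 < C ∧
      ∀ m : ℕ, a₂ ≤ m →
        ∀ F : Finset ℕ, a₁ ∈ F → a₂ ∈ F → (∀ a ∈ F, 1 ≤ a ∧ a ≤ m) →
          ∀ s t : ℝ, 0 < s → moranSumSq F s = 1 →
            0 < t → moranSumSq (insert (m + 1) F) t = 1 →
              c * (2 : ℝ) ^ (-(((m : ℝ) + 1) ^ 2) * t) ≤ t - s ∧
              t - s ≤ C * (2 : ℝ) ^ (-(((m : ℝ) + 1) ^ 2) * t) := by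
  set K : ℝ := ∑' a : ℕ, (a : ℝ) ^ 2 * ((2 : ℝ) ^ (-(1 / (a₂ : ℝ) ^ 2))) ^ a
  have ha₂ : (0 : ℝ) < (a₂ : ℝ) ^ 2 := by
    have : 0 < a₂ := by omega
    positivity
  have hlog : 0 < Real.log 2 := Real.log_pos one_lt_two
  have hK0 : 0 ≤ K := tsum_nonneg fun a => by positivity
  have hKsum : Summable fun a : ℕ => (a : ℝ) ^ 2 * ((2 : ℝ) ^ (-(1 / (a₂ : ℝ) ^ 2))) ^ a := by
    refine summable_pow_mul_geometric_of_norm_lt_one 2 ?_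
    rw [Real.norm_of_nonneg (by positivity)]
    exact Real.rpow_lt_one_of_one_lt_of_neg one_lt_two (by simpa using ha₂)
  refine ⟨1 / (K + 1), (2 : ℝ) ^ ((a₁ : ℝ) ^ 2) / ((a₁ : ℝ) ^ 2 * Real.log 2), by positivity,
    by positivity, ?_⟩
  intro m _ F h₁ h₂ hF s t hs hFs ht hFt
  have hm : m + 1 ∉ F := fun h => by have := (hF _ h).2; omega
  have ht1 : t ≤ 1 := by
    refine le_one_of_moranSumSq_eq_one ?_ hFt
    intro h
    rcases Finset.mem_insert.1 h with h | h
    · omega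
    · have := (hF _ h).1
      omega
  rw [moranSumSq, Finset.sum_insert hm] at hFt
  change _ + moranSumSq F t = 1 at hFt
  push_cast at hFt
  have hε : 0 < (2 : ℝ) ^ (-(((m : ℝ) + 1) ^ 2) * t) := Real.rpow_pos_of_pos two_pos _
  generalize (2 : ℝ) ^ (-(((m : ℝ) + 1) ^ 2) * t) = ε at hFt hε
  have hst : s ≤ t := by
    by_contra! h
    have := moranSumSq_antitone F h.le
    linarith
  have hdiff : ∑ a ∈ F, ((2 : ℝ) ^ (-((a : ℝ) ^ 2) * s) - (2 : ℝ) ^ (-((a : ℝ) ^ 2) * t)) = ε := by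
    rw [Finset.sum_sub_distrib]
    change moranSumSq F s - moranSumSq F t = ε
    linarith
  constructor
  · have hs₂ : 1 / (a₂ : ℝ) ^ 2 ≤ s := by
      rw [div_le_iff₀ ha₂, mul_comm]
      exact one_le_sq_mul_of_moranSumSq_eq_one ha h₁ h₂ hs.le hFs
    have hsumK : ∑ a ∈ F, (a : ℝ) ^ 2 * (2 : ℝ) ^ (-((a : ℝ) ^ 2) * s) ≤ K := by
      refine le_trans (Finset.sum_le_sum fun a _ => ?_)
        (hKsum.sum_le_tsum F fun i _ => by positivity)
      refine mul_le_mul_of_nonneg_left ((two_rpow_neg_sq_mul_le hs.le).trans ?_) (sq_nonneg _)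
      exact pow_le_pow_left₀ (by positivity)
        (Real.rpow_le_rpow_of_exponent_le one_le_two (neg_le_neg hs₂)) _
    have hε_le : ε ≤ (t - s) * K := by
      rw [← hdiff]
      refine le_trans (Finset.sum_le_sum fun a _ => two_rpow_sub_le (sq_nonneg _) hst) ?_
      rw [← Finset.mul_sum]
      exact mul_le_mul_of_nonneg_left hsumK (sub_nonneg.2 hst)
    rw [one_div, inv_mul_le_iff₀ (by linarith)]
    linarith
  · have hterm : (2 : ℝ) ^ (-((a₁ : ℝ) ^ 2) * s) - (2 : ℝ) ^ (-((a₁ : ℝ) ^ 2) * t) ≤ ε := by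
      rw [← hdiff]
      refine Finset.single_le_sum (f := fun a : ℕ =>
        (2 : ℝ) ^ (-((a : ℝ) ^ 2) * s) - (2 : ℝ) ^ (-((a : ℝ) ^ 2) * t)) (fun a _ => ?_) h₁
      refine sub_nonneg.2 (Real.rpow_le_rpow_of_exponent_le one_le_two ?_)
      nlinarith [sq_nonneg (a : ℝ)]
    have hpow : ((2 : ℝ) ^ ((a₁ : ℝ) ^ 2))⁻¹ ≤ (2 : ℝ) ^ (-((a₁ : ℝ) ^ 2) * t) := by
      rw [← Real.rpow_neg two_pos.le]
      refine Real.rpow_le_rpow_of_exponent_le one_le_two ?_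
      nlinarith [sq_nonneg (a₁ : ℝ)]
    have hle : (t - s) * ((a₁ : ℝ) ^ 2 * Real.log 2 * ((2 : ℝ) ^ ((a₁ : ℝ) ^ 2))⁻¹) ≤ ε :=
      (mul_le_mul_of_nonneg_left (mul_le_mul_of_nonneg_left hpow (by positivity))
        (sub_nonneg.2 hst)).trans ((le_two_rpow_sub _ _ _).trans hterm)
    have ha₁' : (0 : ℝ) < (a₁ : ℝ) ^ 2 * Real.log 2 := by positivity
    have hp : (0 : ℝ) < (2 : ℝ) ^ ((a₁ : ℝ) ^ 2) := Real.rpow_pos_of_pos two_pos _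
    rw [div_mul_eq_mul_div, le_div_iff₀ ha₁', ← div_le_iff₀' hp]
    calc _ = (t - s) * ((a₁ : ℝ) ^ 2 * Real.log 2 * ((2 : ℝ) ^ ((a₁ : ℝ) ^ 2))⁻¹) := by ring
      _ ≤ ε := hle
end

section
/- The set { Φ(A) : A ⊆ ℕ } ⊆ ℝ has Hausdorff dimension zero. (This is the quantitative core of Theorem 2.2: the similarity IFS on ℝ with contraction ratios |u_a'| = 2^{-a²}, a ∈ ℕ, satisfying the open set condition, has dimension spectrum of Hausdorff dimension zero.) -/
/-- `Φ(A) = sup{ s(F) : F ⊆ A finite, #F ≥ 2 }` (with `sup ∅ = 0`, which is Lean's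
convention for `sSup` of the empty set of reals), where `s(F)` is the unique positive
root of `Σ_{a∈F} 2^{-a²·s} = 1`; by Bowen's formula, `Φ(A)` is the Hausdorff dimension
of the limit set of the subsystem indexed by `A` of a similarity IFS on `ℝ` satisfying
the OSC with contraction ratios `2^{-a²}`. -/
noncomputable def phiSq (A : Set ℕ) : ℝ :=
  sSup {s : ℝ | 0 < s ∧ ∃ F : Finset ℕ, ↑F ⊆ A ∧ 2 ≤ F.card ∧ moranSumSq F s = 1}

open MeasureTheory Filter Topology
open scoped ENNReal NNReal

lemma continuous_moranSumSq (F : Finset ℕ) : Continuous (moranSumSq F) := by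
  unfold moranSumSq
  refine continuous_finsetSum _ fun a _ => ?_
  exact Continuous.rpow continuous_const (by fun_prop) fun _ => Or.inl (by norm_num)

lemma moranSumSq_le_two_rpow_mul {F : Finset ℕ} (hF : ∀ a ∈ F, 1 ≤ a) {s t : ℝ} (hts : t ≤ s) :
    moranSumSq F s ≤ (2 : ℝ) ^ (-(s - t)) * moranSumSq F t := by
  unfold moranSumSq
  rw [Finset.mul_sum]
  refine Finset.sum_le_sum fun a ha => ?_
  rw [← Real.rpow_add two_pos]
  refine Real.rpow_le_rpow_of_exponent_le one_le_two ?_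
  have h1 : (1 : ℝ) ≤ a := by exact_mod_cast hF a ha
  nlinarith [mul_nonneg (sub_nonneg.2 (one_le_pow₀ h1 (n := 2))) (sub_nonneg.2 hts)]

lemma exists_moranSumSq_eq_one {m : ℕ} {G : Finset ℕ} (hG : ∀ a ∈ G, 1 ≤ a)
    (hm : 2 ≤ (G.filter (· ≤ m)).card) :
    ∃ t : ℝ, 1 / (m : ℝ) ^ 2 ≤ t ∧ moranSumSq G t = 1 := by
  obtain ⟨a₀, ha₀⟩ : (G.filter (· ≤ m)).Nonempty := Finset.card_pos.1 (by omega)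
  rw [Finset.mem_filter] at ha₀
  have hm1 : (1 : ℝ) ≤ m := by exact_mod_cast (hG _ ha₀.1).trans ha₀.2
  have hc1 : (1 : ℝ) ≤ G.card := by exact_mod_cast Finset.card_pos.2 ⟨_, ha₀.1⟩
  have hlow : 1 ≤ moranSumSq G (1 / (m : ℝ) ^ 2) := by
    have hterm : ∀ a ∈ G.filter (· ≤ m),
        (1 / 2 : ℝ) ≤ (2 : ℝ) ^ (-((a : ℝ) ^ 2) * (1 / (m : ℝ) ^ 2)) := by
      intro a ha
      have ham : (a : ℝ) ≤ m := by exact_mod_cast (Finset.mem_filter.1 ha).2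
      have : (1 / 2 : ℝ) = (2 : ℝ) ^ (-1 : ℝ) := by norm_num [Real.rpow_neg_one]
      rw [this]
      refine Real.rpow_le_rpow_of_exponent_le one_le_two ?_
      have : (a : ℝ) ^ 2 / (m : ℝ) ^ 2 ≤ 1 := by
        rw [div_le_one (by positivity)]
        gcongr
      rw [neg_mul, mul_one_div]
      linarith
    have h2 : (2 : ℝ) ≤ ((G.filter (· ≤ m)).card : ℝ) := by exact_mod_cast hm
    calc (1 : ℝ) ≤ (G.filter (· ≤ m)).card • (1 / 2 : ℝ) := by rw [nsmul_eq_mul]; linarith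
      _ ≤ ∑ a ∈ G.filter (· ≤ m), (2 : ℝ) ^ (-((a : ℝ) ^ 2) * (1 / (m : ℝ) ^ 2)) :=
        Finset.card_nsmul_le_sum _ _ _ hterm
      _ ≤ _ := Finset.sum_le_sum_of_subset_of_nonneg (Finset.filter_subset _ _)
        fun _ _ _ => by positivity
  have hhigh : moranSumSq G G.card ≤ 1 := by
    have h := moranSumSq_le_two_rpow_mul hG (Nat.cast_nonneg (α := ℝ) G.card)
    have h0 : moranSumSq G 0 = G.card := by simp [moranSumSq]
    have hlt : (G.card : ℝ) ≤ 2 ^ G.card := by exact_mod_cast Nat.lt_two_pow_self.le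
    rw [h0, sub_zero, Real.rpow_neg two_pos.le, Real.rpow_natCast] at h
    refine h.trans ?_
    rw [inv_mul_le_iff₀ (by positivity)]
    linarith
  have hle : 1 / (m : ℝ) ^ 2 ≤ G.card :=
    (div_le_one (by positivity)).2 (one_le_pow₀ hm1) |>.trans hc1
  obtain ⟨t, ht, h⟩ := intermediate_value_Icc' hle (continuous_moranSumSq G).continuousOn
    ⟨hhigh, hlow⟩
  exact ⟨t, ht.1, h⟩

lemma moranSumSq_le_of_forall_lt {m k : ℕ} (hm : 1 ≤ m) (hk : 1 ≤ k) {H : Finset ℕ}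
    (hH : ∀ a ∈ H, m ^ 2 * k < a) {s : ℝ} (hs : 1 / (m : ℝ) ^ 2 ≤ s) :
    moranSumSq H s ≤ 2 * (1 / 2) ^ (k * (m ^ 2 * k)) := by
  set N := m ^ 2 * k with hN
  have hterm : ∀ a ∈ H, (2 : ℝ) ^ (-((a : ℝ) ^ 2) * s) ≤ (1 / 2) ^ (k * N) * (1 / 2) ^ (a - N) := by
    intro a ha
    have haN := hH a ha
    rw [← pow_add, one_div, inv_pow, ← Real.rpow_natCast _ (k * N + (a - N)),
      ← Real.rpow_neg two_pos.le]
    refine Real.rpow_le_rpow_of_exponent_le one_le_two ?_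
    rw [neg_mul, neg_le_neg_iff]
    have h1 : k * N + (a - N) ≤ k * a := by
      obtain ⟨b, rfl⟩ := Nat.exists_eq_add_of_le haN.le
      rw [Nat.add_sub_cancel_left, mul_add]
      exact Nat.add_le_add_left (Nat.le_mul_of_pos_left b hk) _
    have h2 : (m : ℝ) ^ 2 * k ≤ a := by exact_mod_cast haN.le
    calc ((k * N + (a - N) : ℕ) : ℝ) ≤ ((k * a : ℕ) : ℝ) := by exact_mod_cast h1
      _ = ((m : ℝ) ^ 2 * k) * a * (1 / (m : ℝ) ^ 2) := by push_cast; field_simp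
      _ ≤ a * a * (1 / (m : ℝ) ^ 2) := by gcongr
      _ ≤ (a : ℝ) ^ 2 * s := by rw [sq (a : ℝ)]; gcongr
  have hinj : Set.InjOn (fun a => a - N) (H : Set ℕ) := by
    intro a ha b hb hab
    have := hH a ha
    have := hH b hb
    simp only at hab
    omega
  calc moranSumSq H s ≤ ∑ a ∈ H, (1 / 2 : ℝ) ^ (k * N) * (1 / 2) ^ (a - N) :=
        Finset.sum_le_sum hterm
    _ = (1 / 2 : ℝ) ^ (k * N) * ∑ b ∈ H.image (fun a => a - N), (1 / 2) ^ b := by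
        rw [← Finset.mul_sum, Finset.sum_image hinj]
    _ ≤ (1 / 2 : ℝ) ^ (k * N) * 2 := by
        gcongr
        exact (summable_geometric_two.sum_le_tsum _ fun _ _ => by positivity).trans_eq
          tsum_geometric_two
    _ = _ := mul_comm _ _

lemma phiSq_mem_Icc {m k : ℕ} (hm : 1 ≤ m) (hk : 2 ≤ k) {A : Set ℕ} (hA : ∀ a ∈ A, 1 ≤ a)
    {G : Finset ℕ} (hG : ∀ a, a ∈ G ↔ a ∈ A ∧ a ≤ m ^ 2 * k) (hc : 2 ≤ G.card) {t : ℝ}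
    (ht : 1 / (m : ℝ) ^ 2 ≤ t) (htG : moranSumSq G t = 1) :
    phiSq A ∈ Set.Icc t (t + 8 * (1 / 2) ^ (k * (m ^ 2 * k))) := by
  have ht0 : 0 < t := lt_of_lt_of_le (by positivity) ht
  have hmem : t ∈ {s : ℝ | 0 < s ∧ ∃ F : Finset ℕ, ↑F ⊆ A ∧ 2 ≤ F.card ∧ moranSumSq F s = 1} :=
    ⟨ht0, G, fun a ha => ((hG a).1 ha).1, hc, htG⟩
  have hub : ∀ s ∈ {s : ℝ | 0 < s ∧ ∃ F : Finset ℕ, ↑F ⊆ A ∧ 2 ≤ F.card ∧ moranSumSq F s = 1},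
      s ≤ t + 8 * (1 / 2) ^ (k * (m ^ 2 * k)) := by
    rintro s ⟨-, F, hFA, -, hFs⟩
    rcases le_total s t with hst | hst
    · exact hst.trans (le_add_of_nonneg_right (by positivity))
    have htail := moranSumSq_le_of_forall_lt (H := F.filter fun a => ¬ a ≤ m ^ 2 * k) hm
      (by omega : 1 ≤ k) (fun a ha => not_le.1 (Finset.mem_filter.1 ha).2) (ht.trans hst)
    have hhead : moranSumSq (F.filter (· ≤ m ^ 2 * k)) s ≤ moranSumSq G s := by
      refine Finset.sum_le_sum_of_subset_of_nonneg (fun a ha => ?_) fun _ _ _ => by positivity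
      rw [Finset.mem_filter] at ha
      exact (hG a).2 ⟨hFA ha.1, ha.2⟩
    have hsplit : moranSumSq (F.filter (· ≤ m ^ 2 * k)) s +
        moranSumSq (F.filter fun a => ¬ a ≤ m ^ 2 * k) s = 1 := by
      rw [← hFs]
      exact Finset.sum_filter_add_sum_filter_not _ _ _
    have hdecay := moranSumSq_le_two_rpow_mul (fun a ha => hA a ((hG a).1 ha).1) hst
    rw [htG, mul_one] at hdecay
    have hpow : (2 : ℝ) ^ (-(s - t)) * (1 + (s - t) / 2) ≤ 1 := by
      rw [Real.rpow_neg two_pos.le, inv_mul_le_iff₀ (by positivity), mul_one,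
        Real.rpow_def_of_pos two_pos]
      have h1 := Real.add_one_le_exp (Real.log 2 * (s - t))
      have h2 : (1 / 2 : ℝ) ≤ Real.log 2 := by linarith [Real.log_two_gt_d9]
      nlinarith [sub_nonneg.2 hst]
    have hsmall : (1 / 2 : ℝ) ^ (k * (m ^ 2 * k)) ≤ 1 / 4 := by
      have h1 : 2 ≤ k * (m ^ 2 * k) := by
        have : 1 ≤ m ^ 2 * k := Nat.mul_pos (by positivity) (by omega)
        nlinarith
      calc (1 / 2 : ℝ) ^ (k * (m ^ 2 * k)) ≤ (1 / 2) ^ 2 :=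
            pow_le_pow_of_le_one (by norm_num) (by norm_num) h1
        _ = 1 / 4 := by norm_num
    nlinarith [sub_nonneg.2 hst]
  exact ⟨le_csSup ⟨_, hub⟩ hmem, csSup_le ⟨_, hmem⟩ hub⟩

lemma phiSq_eq_zero {A : Set ℕ} (h : ∀ F : Finset ℕ, ↑F ⊆ A → F.card < 2) : phiSq A = 0 := by
  have hempty :
      {s : ℝ | 0 < s ∧ ∃ F : Finset ℕ, ↑F ⊆ A ∧ 2 ≤ F.card ∧ moranSumSq F s = 1} = ∅ := by
    refine Set.eq_empty_of_forall_notMem ?_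
    rintro s ⟨-, F, hFA, hc, -⟩
    exact (h F hFA).not_ge hc
  rw [phiSq, hempty, Real.sSup_empty]

lemma dimH_image_phiSq_eq_zero {m : ℕ} (hm : 1 ≤ m) :
    dimH (phiSq '' {A | (∀ a ∈ A, 1 ≤ a) ∧
      ∃ F : Finset ℕ, ↑F ⊆ A ∧ 2 ≤ F.card ∧ ∀ a ∈ F, a ≤ m}) = 0 := by
  classical
  choose! root hroot_ge hroot using
    fun (G : Finset ℕ) (h : (∀ a ∈ G, 1 ≤ a) ∧ 2 ≤ (G.filter (· ≤ m)).card) =>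
      exists_moranSumSq_eq_one h.1 h.2
  set ε : ℕ → ℝ := fun k => 8 * (1 / 2) ^ (k * (m ^ 2 * k)) with hε
  have hε0 : ∀ k, 0 ≤ ε k := fun k => by positivity
  have hεlim : Tendsto (fun k => ENNReal.ofReal (ε k)) atTop (𝓝 0) := by
    rw [← ENNReal.ofReal_zero]
    refine ENNReal.tendsto_ofReal ?_
    have hlim : Tendsto (fun k : ℕ => 8 * (1 / 2 : ℝ) ^ k) atTop (𝓝 0) := by
      simpa using (tendsto_pow_atTop_nhds_zero_of_lt_one (r := (1 / 2 : ℝ)) (by norm_num)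
        (by norm_num)).const_mul 8
    refine squeeze_zero' (Eventually.of_forall hε0) ?_ hlim
    filter_upwards [eventually_ge_atTop 1] with k hk
    have : k ≤ k * (m ^ 2 * k) := Nat.le_mul_of_pos_right _ (Nat.mul_pos (by positivity) hk)
    exact mul_le_mul_of_nonneg_left (pow_le_pow_of_le_one (by norm_num) (by norm_num) this)
      (by norm_num)
  let cover : ∀ k, ((Finset.range (m ^ 2 * k + 1)).powerset : Finset (Finset ℕ)) → Set ℝ :=
    fun k G => Set.Icc (root G) (root G + ε k)
  have hdiam : ∀ k G, Metric.ediam (cover k G) = ENNReal.ofReal (ε k) := fun k G => by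
    rw [Real.ediam_Icc, add_sub_cancel_left]
  refine le_antisymm (ENNReal.le_of_forall_pos_le_add fun d hd _ => ?_) zero_le
  rw [zero_add]
  refine dimH_le_of_hausdorffMeasure_ne_top (ne_top_of_le_ne_top ?_
    ((Measure.hausdorffMeasure_le_liminf_sum (d : ℝ) _ _ hεlim cover
      (Eventually.of_forall fun k G => (hdiam k G).le) ?_).trans
      (liminf_le_of_frequently_le' (x := ENNReal.ofReal (2 * 8 ^ (d : ℝ)))
        (Eventually.frequently ?_))))
  · exact ENNReal.ofReal_ne_top
  · filter_upwards [eventually_ge_atTop 2] with k hk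
    rintro _ ⟨A, ⟨hA, F, hFA, hFc, hFm⟩, rfl⟩
    set G := (Finset.range (m ^ 2 * k + 1)).filter (· ∈ A) with hGdef
    have hG : ∀ a, a ∈ G ↔ a ∈ A ∧ a ≤ m ^ 2 * k := fun a => by
      rw [hGdef, Finset.mem_filter, Finset.mem_range, Nat.lt_succ_iff, and_comm]
    have hmN : m ≤ m ^ 2 * k := by nlinarith [Nat.mul_le_mul hm hk, sq m]
    have hFG : F ⊆ G.filter (· ≤ m) := fun a ha =>
      Finset.mem_filter.2 ⟨(hG a).2 ⟨hFA ha, (hFm a ha).trans hmN⟩, hFm a ha⟩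
    have hGm := hFc.trans (Finset.card_le_card hFG)
    have hG1 : (∀ a ∈ G, 1 ≤ a) ∧ 2 ≤ (G.filter (· ≤ m)).card :=
      ⟨fun a ha => hA a ((hG a).1 ha).1, hGm⟩
    exact Set.mem_iUnion.2 ⟨⟨G, Finset.mem_powerset.2 (Finset.filter_subset _ _)⟩,
      phiSq_mem_Icc hm hk hA hG (hGm.trans (Finset.card_le_card (Finset.filter_subset _ _)))
        (hroot_ge G hG1) (hroot G hG1)⟩
  · obtain ⟨K, hK⟩ := exists_nat_ge (1 / (d : ℝ))
    filter_upwards [eventually_ge_atTop K] with k hk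
    have hd' : (0 : ℝ) < d := hd
    have hkd : (1 : ℝ) ≤ k * d := by
      rw [← div_le_iff₀ hd']
      exact hK.trans (by exact_mod_cast hk)
    simp only [hdiam, Finset.sum_const, Finset.card_univ, Fintype.card_coe, Finset.card_powerset,
      Finset.card_range, nsmul_eq_mul]
    rw [ENNReal.ofReal_rpow_of_nonneg (hε0 k) hd'.le, ← ENNReal.ofReal_natCast,
      ← ENNReal.ofReal_mul (Nat.cast_nonneg _)]
    refine ENNReal.ofReal_le_ofReal ?_
    set N := m ^ 2 * k
    have hpow : ((1 / 2 : ℝ) ^ (k * N)) ^ (d : ℝ) ≤ (1 / 2) ^ N := by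
      rw [← Real.rpow_natCast, ← Real.rpow_mul (by norm_num), ← Real.rpow_natCast]
      refine Real.rpow_le_rpow_of_exponent_ge (by norm_num) (by norm_num) ?_
      push_cast
      nlinarith [mul_le_mul_of_nonneg_right hkd (Nat.cast_nonneg (α := ℝ) N)]
    rw [hε]
    simp only
    rw [Real.mul_rpow (by norm_num) (by positivity)]
    push_cast
    calc (2 : ℝ) ^ (N + 1) * (8 ^ (d : ℝ) * ((1 / 2 : ℝ) ^ (k * N)) ^ (d : ℝ))
        ≤ (2 : ℝ) ^ (N + 1) * (8 ^ (d : ℝ) * (1 / 2) ^ N) := by gcongr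
      _ = 2 * 8 ^ (d : ℝ) := by
        rw [pow_succ, one_div, inv_pow]
        field_simp

/-- quantitative core of Theorem 2.2: the dimension spectrum
`{ Φ(A) : A ⊆ ℕ }` of the similarity IFS on `ℝ` with contraction ratios `2^{-a²}`,
`a ∈ ℕ = {1,2,...}`, satisfying the open set condition, has Hausdorff dimension zero. -/
theorem dimH_dimension_spectrum_zero :
    dimH {x : ℝ | ∃ A : Set ℕ, (∀ a ∈ A, 1 ≤ a) ∧ phiSq A = x} = 0 := by
  have hsub : {x : ℝ | ∃ A : Set ℕ, (∀ a ∈ A, 1 ≤ a) ∧ phiSq A = x} ⊆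
      {0} ∪ ⋃ m : ℕ, phiSq '' {A | (∀ a ∈ A, 1 ≤ a) ∧
        ∃ F : Finset ℕ, ↑F ⊆ A ∧ 2 ≤ F.card ∧ ∀ a ∈ F, a ≤ m + 1} := by
    rintro _ ⟨A, hA, rfl⟩
    by_cases h : ∀ F : Finset ℕ, ↑F ⊆ A → F.card < 2
    · exact Or.inl (phiSq_eq_zero h)
    · push Not at h
      obtain ⟨F, hFA, hc⟩ := h
      exact Or.inr (Set.mem_iUnion.2 ⟨F.sup id, A, ⟨hA, F, hFA, hc, fun a ha =>
        (Finset.le_sup (f := id) ha).trans (Nat.le_succ _)⟩, rfl⟩)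
  refine le_antisymm ((dimH_mono hsub).trans ?_) zero_le
  rw [dimH_union, dimH_singleton, dimH_iUnion]
  simp [dimH_image_phiSq_eq_zero]
end

section
/- Let F ⊆ ℝ be a bounded set containing at least two points. Then the set Λ_F := { Σ_{n=0}^∞ a_n·2^{-n} : (a_n)_{n≥0} a sequence with a_n ∈ F for all n } has Hausdorff dimension 1. In particular, for the family of similarities u_a(x) := x/2 + a with a ∈ ℚ∩[0,1] (which satisfies all conditions of a conformal IFS except the open set condition), the Hausdorff dimension of the limit set Λ_F of the subsystem indexed by F ⊆ ℚ∩[0,1] equals 0 if #F ≤ 1 and equals 1 if #F ≥ 2, so the dimension spectrum is {0, 1}, which is not perfect. -/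
open scoped ENNReal

/-- The limit set `Λ_F = { Σ_{n=0}^∞ a_n·2^{-n} : a_n ∈ F for all n }` of the
similarity IFS `{ x ↦ x/2 + a : a ∈ F }`. -/
def halfLimitSet (F : Set ℝ) : Set ℝ :=
  {x : ℝ | ∃ a : ℕ → ℝ, (∀ n : ℕ, a n ∈ F) ∧ x = ∑' n : ℕ, a n * (1 / 2 : ℝ) ^ n}

/-- The limit set contains the segment joining the fixed points `2x`, `2y` of any two of its maps. -/
theorem segment_subset_halfLimitSet {F : Set ℝ} {x y : ℝ} (hx : x ∈ F) (hy : y ∈ F) :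
    segment ℝ (2 * x) (2 * y) ⊆ halfLimitSet F := by
  rw [segment_eq_image']
  rintro _ ⟨t, ht, rfl⟩
  obtain ⟨d, -, rfl⟩ := Real.ofDigits_SurjOn (b := 2) one_lt_two ht
  refine ⟨fun n => if d n = 0 then x else y, fun n => by dsimp only; split_ifs <;> assumption, ?_⟩
  have hsum := (hasSum_geometric_two.mul_left x).add
    ((Real.summable_ofDigitsTerm (digits := d)).hasSum.mul_left (2 * (y - x)))
  convert! hsum.tsum_eq.symm using 1
  · simp only [Real.ofDigits, smul_eq_mul]
    ring
  · refine tsum_congr fun n => ?_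
    have hd : d n = 0 ∨ d n = 1 := by omega
    rcases hd with h | h
    · simp [Real.ofDigitsTerm, h]
    · simp [Real.ofDigitsTerm, h, pow_succ]
      ring

theorem dimH_halfLimitSet_of_nontrivial {F : Set ℝ} (hF : F.Nontrivial) :
    dimH (halfLimitSet F) = 1 := by
  obtain ⟨x, hx, y, hy, hxy⟩ := hF
  apply le_antisymm
  · simpa only [Real.dimH_univ] using dimH_mono (Set.subset_univ (halfLimitSet F))
  · have hne : 2 * x ≠ 2 * y := by simpa using hxy
    simpa only [Real.dimH_segment hne] using dimH_mono (segment_subset_halfLimitSet hx hy)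

theorem halfLimitSet_subsingleton {F : Set ℝ} (hF : F.Subsingleton) :
    (halfLimitSet F).Subsingleton := by
  rintro _ ⟨a, ha, rfl⟩ _ ⟨b, hb, rfl⟩
  exact tsum_congr fun n => by rw [hF (ha n) (hb n)]

/-- For every bounded `F ⊆ ℝ` with at least two points, `Λ_F` has
Hausdorff dimension `1`.  In particular, for the family `u_a(x) = x/2 + a`,
`a ∈ ℚ ∩ [0,1]` (satisfying all conditions of a conformal IFS except the OSC), the
Hausdorff dimension of `Λ_F` for `F ⊆ ℚ ∩ [0,1]` is `0` if `#F ≤ 1` and `1` if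
`#F ≥ 2`, so the dimension spectrum is `{0, 1}`, which is not perfect. -/
theorem dimH_halfLimitSet :
    (∀ F : Set ℝ, Bornology.IsBounded F → F.Nontrivial → dimH (halfLimitSet F) = 1) ∧
    (∀ F : Set ℝ, F ⊆ {x : ℝ | ∃ q : ℚ, (q : ℝ) = x} ∩ Set.Icc 0 1 →
      (F.Subsingleton → dimH (halfLimitSet F) = 0) ∧
      (F.Nontrivial → dimH (halfLimitSet F) = 1)) ∧
    {d : ℝ≥0∞ | ∃ F : Set ℝ, F ⊆ {x : ℝ | ∃ q : ℚ, (q : ℝ) = x} ∩ Set.Icc 0 1 ∧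
        dimH (halfLimitSet F) = d} = {0, 1} ∧
    ¬ Perfect ({0, 1} : Set ℝ≥0∞) := by
  refine ⟨fun F _ hF => dimH_halfLimitSet_of_nontrivial hF,
    fun F _ => ⟨fun hF => (halfLimitSet_subsingleton hF).dimH_zero,
      dimH_halfLimitSet_of_nontrivial⟩, ?_, fun h => ?_⟩
  · refine Set.Subset.antisymm ?_ ?_
    · rintro _ ⟨F, -, rfl⟩
      exact F.subsingleton_or_nontrivial.imp
        (fun hF => (halfLimitSet_subsingleton hF).dimH_zero) dimH_halfLimitSet_of_nontrivial
    · rintro d (rfl | rfl)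
      · exact ⟨∅, Set.empty_subset _,
          (halfLimitSet_subsingleton Set.subsingleton_empty).dimH_zero⟩
      · refine ⟨{0, 1}, ?_, dimH_halfLimitSet_of_nontrivial (Set.nontrivial_pair zero_ne_one)⟩
        rintro _ (rfl | rfl)
        · exact ⟨⟨0, Rat.cast_zero⟩, by simp⟩
        · exact ⟨⟨1, Rat.cast_one⟩, by simp⟩
  · exact Set.Infinite.of_accPt (h.acc 0 (Set.mem_insert 0 _)) (Set.toFinite _)
end

section
/- The set { Ψ(A) : A ⊆ ℕ } ⊆ ℝ is equal to the union of finitely many closed bounded intervals, each with nonempty interior, together with the point 0 if necessary; that is, the dimension spectrum of any similarity IFS on ℝ satisfying the open set condition whose contraction ratios are 2^{-a}, a ∈ ℕ, is equal to the union of finitely many intervals. -/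
/-- The Moran sum `Σ_{a ∈ F} 2^{-a·s}` for a finite set `F ⊆ ℕ`. -/
noncomputable def moranSumLin (F : Finset ℕ) (s : ℝ) : ℝ :=
  ∑ a ∈ F, (2 : ℝ) ^ (-(a : ℝ) * s)

/-- `Ψ(A) = sup{ t(F) : F ⊆ A finite, #F ≥ 2 }` (with `sup ∅ = 0`, which is Lean's
convention for `sSup` of the empty set of reals), where `t(F)` is the unique positive
root of `Σ_{a∈F} 2^{-a·s} = 1`; by Bowen's formula, `Ψ(A)` is the Hausdorff dimension
of the limit set of the subsystem indexed by `A` of a similarity IFS on `ℝ` satisfying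
the OSC with contraction ratios `2^{-a}`. -/
noncomputable def psiLin (A : Set ℕ) : ℝ :=
  sSup {s : ℝ | 0 < s ∧ ∃ F : Finset ℕ, ↑F ⊆ A ∧ 2 ≤ F.card ∧ moranSumLin F s = 1}

/-- The remainder left after the first `n` steps of the greedy expansion of `1` in powers of `x`. -/
noncomputable def greedyRemainder (x : ℝ) : ℕ → ℝ
  | 0 => 1
  | n + 1 =>
    if x ^ (n + 1) ≤ greedyRemainder x n then greedyRemainder x n - x ^ (n + 1)
    else greedyRemainder x n

/-- The exponents selected by the greedy expansion of `1` in powers of `x`. -/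
def greedySet (x : ℝ) : Set ℕ :=
  {n | 1 ≤ n ∧ x ^ n ≤ greedyRemainder x (n - 1)}

theorem greedyRemainder_nonneg (x : ℝ) (n : ℕ) : 0 ≤ greedyRemainder x n := by
  induction n with
  | zero => simp [greedyRemainder]
  | succ n ih =>
    rw [greedyRemainder]
    split_ifs with h
    · linarith
    · exact ih

theorem greedyRemainder_mul_le {x : ℝ} (hx : 1 / 2 ≤ x) (n : ℕ) :
    greedyRemainder x n * (1 - x) ≤ x ^ (n + 1) := by
  induction n with
  | zero =>
    simp only [greedyRemainder, zero_add, pow_one]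
    linarith
  | succ n ih =>
    have hp : 0 < x ^ (n + 1) := by positivity
    rw [greedyRemainder, pow_succ x (n + 1)]
    split_ifs with h
    · nlinarith
    · rcases le_or_gt x 1 with h1 | h1
      · nlinarith
      · nlinarith [mul_nonneg (greedyRemainder_nonneg x n) (sub_nonneg.2 h1.le)]

open Classical in
theorem sum_greedySet_range (x : ℝ) (n : ℕ) :
    ∑ a ∈ (Finset.range (n + 1)).filter (· ∈ greedySet x), x ^ a = 1 - greedyRemainder x n := by
  induction n with
  | zero => simp [greedyRemainder, Finset.sum_filter, greedySet]
  | succ n ih =>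
    rw [Finset.sum_filter] at ih ⊢
    rw [Finset.sum_range_succ, ih, greedyRemainder]
    by_cases h : x ^ (n + 1) ≤ greedyRemainder x n
    · have hmem : n + 1 ∈ greedySet x := ⟨by omega, by simpa using h⟩
      rw [if_pos h, if_pos hmem]
      ring
    · have hmem : n + 1 ∉ greedySet x := fun hm => h (by simpa using hm.2)
      rw [if_neg h, if_neg hmem]
      ring

theorem sum_le_one_of_subset_greedySet {x : ℝ} (hx : 0 ≤ x) {F : Finset ℕ}
    (hF : ↑F ⊆ greedySet x) : ∑ a ∈ F, x ^ a ≤ 1 := by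
  classical
  have hsub : F ⊆ (Finset.range (F.sup id + 1)).filter (· ∈ greedySet x) := by
    intro a ha
    rw [Finset.mem_filter, Finset.mem_range]
    exact ⟨Nat.lt_succ_of_le (Finset.le_sup (f := id) ha), hF ha⟩
  have h := Finset.sum_le_sum_of_subset_of_nonneg (f := fun a => x ^ a) hsub
    fun a _ _ => pow_nonneg hx a
  rw [sum_greedySet_range] at h
  linarith [greedyRemainder_nonneg x (F.sup id)]

theorem exists_subset_greedySet_lt_sum {x : ℝ} (hx : 1 / 2 ≤ x) (hx1 : x < 1) {c : ℝ}
    (hc : c < 1) : ∃ F : Finset ℕ, ↑F ⊆ greedySet x ∧ c < ∑ a ∈ F, x ^ a := by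
  classical
  obtain ⟨n, hn⟩ := exists_pow_lt_of_lt_one
    (mul_pos (sub_pos.2 hc) (sub_pos.2 hx1)) hx1
  refine ⟨(Finset.range (n + 1)).filter (· ∈ greedySet x), fun a ha => ?_, ?_⟩
  · exact (Finset.mem_filter.1 ha).2
  · rw [sum_greedySet_range]
    have h1 := greedyRemainder_mul_le hx n
    have h2 : x ^ (n + 1) ≤ x ^ n := pow_le_pow_of_le_one (by linarith) hx1.le n.le_succ
    have h3 : greedyRemainder x n < 1 - c :=
      lt_of_mul_lt_mul_right (by linarith) (sub_pos.2 hx1).le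
    linarith

theorem moranSumLin_eq_sum_pow (F : Finset ℕ) (s : ℝ) :
    moranSumLin F s = ∑ a ∈ F, ((2 : ℝ) ^ (-s)) ^ a := by
  refine Finset.sum_congr rfl fun a _ => ?_
  rw [← Real.rpow_mul_natCast (by norm_num)]
  congr 1
  ring

theorem continuous_moranSumLin (F : Finset ℕ) : Continuous (moranSumLin F) := by
  unfold moranSumLin
  refine continuous_finsetSum F fun a _ => ?_
  exact Continuous.rpow continuous_const (by fun_prop) fun _ => Or.inl two_ne_zero

theorem rpow_mul_moranSumLin_le {F : Finset ℕ} (hF : ∀ a ∈ F, 1 ≤ a) {t s : ℝ} (hts : t ≤ s) :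
    (2 : ℝ) ^ (s - t) * moranSumLin F s ≤ moranSumLin F t := by
  unfold moranSumLin
  rw [Finset.mul_sum]
  refine Finset.sum_le_sum fun a ha => ?_
  rw [← Real.rpow_add two_pos]
  refine Real.rpow_le_rpow_of_exponent_le one_le_two ?_
  have : (1 : ℝ) ≤ a := by exact_mod_cast hF a ha
  nlinarith

/-- A value at which the finite subsums of the Moran series of `A` have supremum `1` is `Ψ(A)`. -/
theorem psiLin_eq_of_moranSumLin {A : Set ℕ} (hA : ∀ a ∈ A, 1 ≤ a) {s : ℝ} (hs : 0 < s)
    (hle : ∀ F : Finset ℕ, ↑F ⊆ A → moranSumLin F s ≤ 1)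
    (hlt : ∀ c < 1, ∃ F : Finset ℕ, ↑F ⊆ A ∧ c < moranSumLin F s) : psiLin A = s := by
  have hub : ∀ t ∈ {s : ℝ | 0 < s ∧ ∃ F : Finset ℕ, ↑F ⊆ A ∧ 2 ≤ F.card ∧ moranSumLin F s = 1},
      t ≤ s := by
    rintro t ⟨-, F, hFA, -, hF⟩
    by_contra! hst
    have h1 := rpow_mul_moranSumLin_le (fun a ha => hA a (hFA ha)) hst.le
    have h2 := Real.one_lt_rpow one_lt_two (sub_pos.2 hst)
    rw [hF] at h1
    linarith [hle F hFA]
  refine le_antisymm (Real.sSup_le hub hs.le) (le_of_forall_lt fun u hu => ?_)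
  obtain ⟨t, ht, hts⟩ := exists_between (max_lt hu hs)
  obtain ⟨hut, ht0⟩ := max_lt_iff.1 ht
  have hp := Real.rpow_pos_of_pos two_pos (s - t)
  obtain ⟨F, hFA, hF⟩ := hlt ((2 : ℝ) ^ (s - t))⁻¹
    (inv_lt_one_of_one_lt₀ (Real.one_lt_rpow one_lt_two (sub_pos.2 hts)))
  have hF1 : ∀ a ∈ F, 1 ≤ a := fun a ha => hA a (hFA ha)
  have hFt : 1 < moranSumLin F t :=
    ((inv_lt_iff_one_lt_mul₀' hp).1 hF).trans_le (rpow_mul_moranSumLin_le hF1 hts.le)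
  have hcard : 2 ≤ F.card := by
    have hsum : moranSumLin F t ≤ ∑ _a ∈ F, (1 : ℝ) := by
      refine Finset.sum_le_sum fun a _ => Real.rpow_le_one_of_one_le_of_nonpos one_le_two ?_
      have : (0 : ℝ) ≤ a := a.cast_nonneg
      nlinarith
    have : (1 : ℝ) < F.card := hFt.trans_le (by simpa using hsum)
    exact_mod_cast this
  obtain ⟨v, hv, hFv⟩ := intermediate_value_Icc' hts.le (continuous_moranSumLin F).continuousOn
    ⟨hle F hFA, hFt.le⟩
  exact (hut.trans_le hv.1).trans_le
    (le_csSup ⟨s, hub⟩ ⟨ht0.trans_le hv.1, F, hFA, hcard, hFv⟩)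

theorem moranSumLin_one_le {F : Finset ℕ} (hF : ∀ a ∈ F, 1 ≤ a) : moranSumLin F 1 ≤ 1 := by
  rw [moranSumLin_eq_sum_pow]
  have hsum : HasSum (fun n : ℕ => ((2 : ℝ) ^ (-1 : ℝ)) ^ n) 2 := by
    rw [Real.rpow_neg_one, ← one_div]
    exact hasSum_geometric_two
  have h0 : 0 ∉ F := fun h => absurd (hF 0 h) (by norm_num)
  have h := sum_le_hasSum (insert 0 F) (fun n _ => by positivity) hsum
  rw [Finset.sum_insert h0, pow_zero] at h
  linarith

theorem psiLin_mem_Icc {A : Set ℕ} (hA : ∀ a ∈ A, 1 ≤ a) : psiLin A ∈ Set.Icc (0 : ℝ) 1 := by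
  refine ⟨Real.sSup_nonneg fun t ht => ht.1.le, Real.sSup_le ?_ zero_le_one⟩
  rintro t ⟨-, F, hFA, -, hF⟩
  by_contra! ht
  have hF1 : ∀ a ∈ F, 1 ≤ a := fun a ha => hA a (hFA ha)
  have h1 := rpow_mul_moranSumLin_le hF1 ht.le
  have h2 := Real.one_lt_rpow one_lt_two (sub_pos.2 ht)
  rw [hF] at h1
  linarith [moranSumLin_one_le hF1]

theorem psiLin_empty : psiLin ∅ = 0 := by
  unfold psiLin
  convert Real.sSup_empty
  refine Set.eq_empty_of_forall_notMem ?_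
  rintro t ⟨-, F, hF, hcard, -⟩
  simp [Finset.coe_eq_empty.1 (Set.subset_empty_iff.1 hF)] at hcard

theorem exists_psiLin_eq {s : ℝ} (hs : s ∈ Set.Icc (0 : ℝ) 1) :
    ∃ A : Set ℕ, (∀ a ∈ A, 1 ≤ a) ∧ psiLin A = s := by
  rcases hs.1.eq_or_lt with rfl | hs0
  · exact ⟨∅, by simp, psiLin_empty⟩
  have hx1 : (2 : ℝ) ^ (-s) < 1 := Real.rpow_lt_one_of_one_lt_of_neg one_lt_two (by linarith)
  have hx : 1 / 2 ≤ (2 : ℝ) ^ (-s) := by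
    rw [one_div, ← Real.rpow_neg_one]
    exact Real.rpow_le_rpow_of_exponent_le one_le_two (by linarith [hs.2])
  refine ⟨greedySet ((2 : ℝ) ^ (-s)), fun a ha => ha.1,
    psiLin_eq_of_moranSumLin (fun a ha => ha.1) hs0 (fun F hF => ?_) fun c hc => ?_⟩
  · rw [moranSumLin_eq_sum_pow]
    exact sum_le_one_of_subset_greedySet (by linarith) hF
  · simp only [moranSumLin_eq_sum_pow]
    exact exists_subset_greedySet_lt_sum hx hx1 hc

/-- The dimension spectrum `{ Ψ(A) : A ⊆ ℕ }` of any similarity IFS on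
`ℝ` satisfying the open set condition with contraction ratios `2^{-a}`,
`a ∈ ℕ = {1,2,...}`, is the union of finitely many closed bounded intervals, each with
nonempty interior, together with the point `0` if necessary. -/
theorem psi_spectrum_finitely_many_intervals :
    ∃ (k : ℕ) (lo hi : Fin k → ℝ), (∀ i, lo i < hi i) ∧
      {x : ℝ | ∃ A : Set ℕ, (∀ a ∈ A, 1 ≤ a) ∧ psiLin A = x} =
        {0} ∪ ⋃ i : Fin k, Set.Icc (lo i) (hi i) := by
  refine ⟨1, fun _ => 0, fun _ => 1, fun _ => zero_lt_one, ?_⟩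
  rw [Set.iUnion_const, Set.union_eq_right.2 (Set.singleton_subset_iff.2 (by simp))]
  ext x
  refine ⟨?_, exists_psiLin_eq⟩
  rintro ⟨A, hA, rfl⟩
  exact psiLin_mem_Icc hA
end
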